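/- arXiv:2010.15038 — 5 statements merged into one kernel-verified Lean document; each statement's English description precedes it below -/
import Mathlib

section
/- Any two conformal groups of order 8 are isomorphic (i.e., 8 ∈ S). -/
/-- Two groups are conformal if for every natural number `d` they have the same number of
elements of order `d`. -/
def ConformalGroups (G H : Type*) [Group G] [Group H] : Prop :=
  ∀ d : ℕ, Nat.card {g : G // orderOf g = d} = Nat.card {h : H // orderOf h = d}

section OrderEight

variable {G : Type*} [Group G]

lemma pow_zmod_val_add {n : ℕ} [NeZero n] {a : G} (ha : a ^ n = 1) (i j : ZMod n) :
    a ^ (i + j).val = a ^ i.val * a ^ j.val := by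
  rw [ZMod.val_add, ← pow_add, ← pow_mod_orderOf,
    Nat.mod_mod_of_dvd _ (orderOf_dvd_of_pow_eq_one ha), pow_mod_orderOf]

lemma pow_zmod_val_sub {n : ℕ} [NeZero n] {a : G} (ha : a ^ n = 1) (i j : ZMod n) :
    a ^ (i - j).val = (a ^ j.val)⁻¹ * a ^ i.val := by
  rw [eq_inv_mul_iff_mul_eq, ← pow_zmod_val_add ha, add_sub_cancel]

lemma pow_zmod_val_injective {n : ℕ} [NeZero n] {a : G} (ha : orderOf a = n) {i j : ZMod n}
    (h : a ^ i.val = a ^ j.val) : i = j :=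
  ZMod.val_injective n <| pow_injOn_Iio_orderOf (by simpa [ha] using ZMod.val_lt i)
    (by simpa [ha] using ZMod.val_lt j) h

lemma pow_mul_eq_mul_inv_pow {a b : G} (hab : a * b = b * a⁻¹) (k : ℕ) :
    a ^ k * b = b * (a ^ k)⁻¹ := by
  have h : SemiconjBy b a⁻¹ a := hab.symm
  simpa using (h.pow_right k).eq.symm

lemma mul_pow_ne_pow {a b : G} (hb : b ∉ Subgroup.zpowers a) (k l : ℕ) : b * a ^ k ≠ a ^ l := by
  intro h
  refine hb ?_
  rw [eq_mul_inv_of_mul_eq h]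
  exact mul_mem (Subgroup.npow_mem_zpowers a l) (inv_mem (Subgroup.npow_mem_zpowers a k))

lemma nonempty_mulEquiv_dihedralGroup_four (hG : Nat.card G = 8) {a b : G} (ha : orderOf a = 4)
    (hb : b ∉ Subgroup.zpowers a) (hab : a * b = b * a⁻¹) (hbb : b * b = 1) :
    Nonempty (G ≃* DihedralGroup 4) := by
  have ha4 : a ^ 4 = 1 := ha ▸ pow_orderOf_eq_one a
  let f : DihedralGroup 4 →* G := MonoidHom.mk'
    (fun | .r i => a ^ i.val | .sr i => b * a ^ i.val) <| by
      have hc (k : ℕ) (x : G) : a ^ k * (b * x) = b * ((a ^ k)⁻¹ * x) := by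
        rw [← mul_assoc, pow_mul_eq_mul_inv_pow hab, mul_assoc]
      have hbb' (x : G) : b * (b * x) = x := by rw [← mul_assoc, hbb, one_mul]
      rintro (i | i) (j | j) <;>
        simp [pow_zmod_val_add ha4, pow_zmod_val_sub ha4, mul_assoc, hc, hbb']
  have hf : Function.Injective f := by
    rintro (i | i) (j | j) h
    · exact congrArg _ (pow_zmod_val_injective ha h)
    · exact absurd h.symm (mul_pow_ne_pow hb _ _)
    · exact absurd h (mul_pow_ne_pow hb _ _)
    · exact congrArg _ (pow_zmod_val_injective ha (mul_left_cancel h))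
  have : Finite G := Nat.finite_of_card_ne_zero (by omega)
  exact ⟨(MulEquiv.ofBijective f ((Nat.bijective_iff_injective_and_card f).2
    ⟨hf, by rw [hG, DihedralGroup.nat_card]⟩)).symm⟩

lemma nonempty_mulEquiv_quaternionGroup_two (hG : Nat.card G = 8) {a b : G} (ha : orderOf a = 4)
    (hb : b ∉ Subgroup.zpowers a) (hab : a * b = b * a⁻¹) (hbb : b * b = a ^ 2) :
    Nonempty (G ≃* QuaternionGroup 2) := by
  have ha4 : a ^ (2 * 2) = 1 := orderOf_dvd_iff_pow_eq_one.1 ha.dvd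
  let f : QuaternionGroup 2 →* G := MonoidHom.mk'
    (fun | .a i => a ^ i.val | .xa i => b * a ^ i.val) <| by
      have hc (k : ℕ) (x : G) : a ^ k * (b * x) = b * ((a ^ k)⁻¹ * x) := by
        rw [← mul_assoc, pow_mul_eq_mul_inv_pow hab, mul_assoc]
      have hbb' (x : G) : b * (b * x) = a ^ 2 * x := by rw [← mul_assoc, hbb]
      have h2 : a ^ (2 : ZMod (2 * 2)).val = a ^ 2 := rfl
      have hcomm (k : ℕ) (x : G) : (a ^ k)⁻¹ * (a ^ 2 * x) = a ^ 2 * ((a ^ k)⁻¹ * x) := by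
        rw [← mul_assoc, ← mul_assoc, ((Commute.refl a).pow_pow k 2).inv_left.eq]
      rintro (i | i) (j | j) <;>
        simp [pow_zmod_val_add ha4, pow_zmod_val_sub ha4, mul_assoc, hc, hbb', h2, hcomm]
  have hf : Function.Injective f := by
    rintro (i | i) (j | j) h
    · exact congrArg _ (pow_zmod_val_injective ha h)
    · exact absurd h.symm (mul_pow_ne_pow hb _ _)
    · exact absurd h (mul_pow_ne_pow hb _ _)
    · exact congrArg _ (pow_zmod_val_injective ha (mul_left_cancel h))
  have : Finite G := Nat.finite_of_card_ne_zero (by omega)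
  exact ⟨(MulEquiv.ofBijective f ((Nat.bijective_iff_injective_and_card f).2
    ⟨hf, by rw [hG, Nat.card_eq_fintype_card, QuaternionGroup.card]⟩)).symm⟩

lemma nonempty_mulEquiv_zmod_four_prod_zmod_two (hG : Nat.card G = 8) {a b : G}
    (ha : orderOf a = 4) (hb : b ∉ Subgroup.zpowers a) (hab : a * b = b * a) (hbb : b * b = 1) :
    Nonempty (G ≃* Multiplicative (ZMod 4 × ZMod 2)) := by
  have ha4 : a ^ 4 = 1 := ha ▸ pow_orderOf_eq_one a
  have hb2 : b ^ 2 = 1 := by rw [sq, hbb]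
  let f : Multiplicative (ZMod 4 × ZMod 2) →* G := MonoidHom.mk'
    (fun x => b ^ x.toAdd.2.val * a ^ x.toAdd.1.val) <| by
      intro x y
      simp only [toAdd_mul, Prod.fst_add, Prod.snd_add, pow_zmod_val_add ha4,
        pow_zmod_val_add hb2]
      have h : Commute a b := hab
      exact (h.symm.pow_pow _ _).mul_mul_mul_comm _ _
  have hf : Function.Injective f := by
    rw [injective_iff_map_eq_one]
    intro x h
    obtain ⟨⟨i, j⟩, rfl⟩ := Multiplicative.ofAdd.surjective x
    change b ^ j.val * a ^ i.val = 1 at h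
    obtain rfl | rfl : j = 0 ∨ j = 1 := by clear h; revert j; decide
    · rw [ZMod.val_zero, pow_zero, one_mul] at h
      obtain rfl : i = 0 := pow_zmod_val_injective ha (by simpa using h)
      rfl
    · exact absurd (by simpa [ZMod.val_one] using h) (mul_pow_ne_pow hb i.val 0)
  have : Finite G := Nat.finite_of_card_ne_zero (by omega)
  exact ⟨(MulEquiv.ofBijective f ((Nat.bijective_iff_injective_and_card f).2
    ⟨hf, by simp [hG, Nat.card_eq_fintype_card]⟩)).symm⟩

lemma orderOf_mem_of_card_eq_eight (hG : Nat.card G = 8) (g : G) :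
    orderOf g = 1 ∨ orderOf g = 2 ∨ orderOf g = 4 ∨ orderOf g = 8 := by
  have h : orderOf g ∈ Nat.divisors 8 := by
    simpa [hG] using orderOf_dvd_natCard g
  rw [show Nat.divisors 8 = {1, 2, 4, 8} from by decide] at h
  simpa using h

lemma eq_of_mem_zpowers_of_orderOf_eq_four {a x : G} (ha : orderOf a = 4)
    (hx : x ∈ Subgroup.zpowers a) :
    x = 1 ∨ x = a ∨ x = a ^ 2 ∨ x = a⁻¹ := by
  classical
  have hf : IsOfFinOrder a := orderOf_pos_iff.1 (by omega)
  rw [← hf.mem_powers_iff_mem_zpowers, hf.mem_powers_iff_mem_range_orderOf, ha] at hx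
  obtain ⟨k, hk, rfl⟩ := Finset.mem_image.1 hx
  have h3 : a ^ 3 = a⁻¹ := by
    rw [eq_inv_iff_mul_eq_one, ← pow_succ]
    exact orderOf_dvd_iff_pow_eq_one.1 ha.dvd
  rw [Finset.mem_range] at hk
  interval_cases k <;> simp [h3]

lemma nonempty_mulEquiv_of_orderOf_eq_four (hG : Nat.card G = 8) (h8 : ∀ g : G, orderOf g ≠ 8)
    {a : G} (ha : orderOf a = 4) :
    Nonempty (G ≃* Multiplicative (ZMod 4 × ZMod 2)) ∨ Nonempty (G ≃* DihedralGroup 4) ∨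
      Nonempty (G ≃* QuaternionGroup 2) := by
  have ha4 : a ^ 4 = 1 := ha ▸ pow_orderOf_eq_one a
  have hidx : (Subgroup.zpowers a).index = 2 := by
    have := (Subgroup.zpowers a).card_mul_index
    rw [Nat.card_zpowers, ha, hG] at this
    omega
  have hnormal := Subgroup.normal_of_index_eq_two hidx
  obtain ⟨b, hb⟩ : ∃ b, b ∉ Subgroup.zpowers a := by
    by_contra! h
    rw [(Subgroup.eq_top_iff' _).2 h, Subgroup.index_top] at hidx
    omega
  have hbb : b * b = 1 ∨ b * b = a ^ 2 := by
    have key : orderOf (b ^ 2) ≠ 4 := by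
      intro h
      rw [orderOf_pow' b two_ne_zero] at h
      rcases orderOf_mem_of_card_eq_eight hG b with hb' | hb' | hb' | hb'
      iterate 3 simp [hb'] at h
      exact h8 b hb'
    rw [sq] at key
    rcases eq_of_mem_zpowers_of_orderOf_eq_four ha (Subgroup.mul_self_mem_of_index_two hidx b)
      with h | h | h | h
    · exact .inl h
    · exact absurd (h ▸ ha) key
    · exact .inr h
    · exact absurd (by rw [h, orderOf_inv, ha]) key
  have hab : a * b = b * a ∨ a * b = b * a⁻¹ := by
    have hmem : b⁻¹ * a * b ∈ Subgroup.zpowers a := by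
      simpa using hnormal.conj_mem a (Subgroup.mem_zpowers a) b⁻¹
    have hord : orderOf (b⁻¹ * a * b) = 4 := by
      have hsemi : SemiconjBy b (b⁻¹ * a * b) a := by simp [SemiconjBy, mul_assoc]
      rw [← ha, hsemi.orderOf_eq]
    have hmul : a * b = b * (b⁻¹ * a * b) := by group
    rcases eq_of_mem_zpowers_of_orderOf_eq_four ha hmem with h | h | h | h
    · simp [h] at hord
    · exact .inl (by rw [hmul, h])
    · rw [h, orderOf_pow' a two_ne_zero, ha] at hord
      norm_num at hord
    · exact .inr (by rw [hmul, h])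
  rcases hab with hab | hab
  · left
    rcases hbb with hbb | hbb
    · exact nonempty_mulEquiv_zmod_four_prod_zmod_two hG ha hb hab hbb
    · refine nonempty_mulEquiv_zmod_four_prod_zmod_two (b := a * b) hG ha
        (fun h => hb ((Subgroup.mul_mem_cancel_left _ (Subgroup.mem_zpowers a)).1 h)) ?_ ?_
      · rw [mul_assoc a b a, hab]
      · rw [mul_assoc, ← mul_assoc b, ← hab, mul_assoc, hbb, ← mul_assoc, ← sq, ← pow_add, ha4]
  · right
    rcases hbb with hbb | hbb
    · exact .inl (nonempty_mulEquiv_dihedralGroup_four hG ha hb hab hbb)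
    · exact .inr (nonempty_mulEquiv_quaternionGroup_two hG ha hb hab hbb)

lemma mul_comm_of_forall_sq_eq_one (hG : ∀ g : G, g ^ 2 = 1) (a b : G) : a * b = b * a := by
  have hinv (g : G) : g⁻¹ = g := inv_eq_of_mul_eq_one_left (by rw [← sq, hG])
  rw [← hinv (a * b), mul_inv_rev, hinv, hinv]

lemma nonempty_mulEquiv_of_forall_sq_eq_one {H : Type*} [Group H] [Finite G] [Finite H]
    (hcard : Nat.card G = Nat.card H) (hG : ∀ g : G, g ^ 2 = 1) (hH : ∀ h : H, h ^ 2 = 1) :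
    Nonempty (G ≃* H) := by
  let _ : CommGroup G := { ‹Group G› with
    mul_comm := mul_comm_of_forall_sq_eq_one hG }
  let _ : CommGroup H := { ‹Group H› with
    mul_comm := mul_comm_of_forall_sq_eq_one hH }
  let _ : Module (ZMod 2) (Additive G) := AddCommGroup.zmodModule (n := 2) hG
  let _ : Module (ZMod 2) (Additive H) := AddCommGroup.zmodModule (n := 2) hH
  have hrank : Module.finrank (ZMod 2) (Additive G) = Module.finrank (ZMod 2) (Additive H) := by
    refine Nat.pow_right_injective le_rfl ?_
    have h1 := Module.natCard_eq_pow_finrank (K := ZMod 2) (V := Additive G)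
    have h2 := Module.natCard_eq_pow_finrank (K := ZMod 2) (V := Additive H)
    rw [Nat.card_zmod] at h1 h2
    exact h1.symm.trans (hcard.trans h2)
  obtain ⟨e⟩ := FiniteDimensional.nonempty_linearEquiv_of_finrank_eq hrank
  exact ⟨MulEquiv.toAdditive.symm e.toAddEquiv⟩

lemma natCard_orderOf_eq_two_congr {H : Type*} [Group H] [Fintype H] [DecidableEq H]
    (e : G ≃* H) :
    Nat.card {g : G // orderOf g = 2} = Fintype.card {h : H // h ^ 2 = 1 ∧ h ≠ 1} := by
  rw [← Nat.card_eq_fintype_card]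
  refine Nat.card_congr (e.toEquiv.subtypeEquiv fun g => ?_)
  rw [← orderOf_eq_prime_iff]
  simp

lemma ConformalGroups.exists_orderOf_eq {H : Type*} [Group H] [Finite H]
    (h : ConformalGroups G H) (x : H) : ∃ g : G, orderOf g = orderOf x := by
  have hne : Nonempty {y : H // orderOf y = orderOf x} := ⟨⟨x, rfl⟩⟩
  have hpos : 0 < Nat.card {g : G // orderOf g = orderOf x} := h _ ▸ Nat.card_pos
  obtain ⟨⟨g, hg⟩⟩ := (Nat.card_pos_iff.1 hpos).1
  exact ⟨g, hg⟩

end OrderEight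

/-- Any two conformal groups of order 8 are isomorphic. -/
theorem stmt_1 (G H : Type*) [Group G] [Fintype G] [Group H] [Fintype H]
    (hG : Fintype.card G = 8) (hH : Fintype.card H = 8)
    (hconf : ConformalGroups G H) :
    Nonempty (G ≃* H) := by
  rw [← Nat.card_eq_fintype_card] at hG hH
  have hconf' : ConformalGroups H G := fun d => (hconf d).symm
  by_cases h8 : ∃ g : G, orderOf g = 8
  · obtain ⟨g, hg⟩ := h8
    obtain ⟨h, hh⟩ := hconf'.exists_orderOf_eq g
    have := isCyclic_of_orderOf_eq_card g (hg.trans hG.symm)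
    have := isCyclic_of_orderOf_eq_card h ((hh.trans hg).trans hH.symm)
    exact ⟨mulEquivOfCyclicCardEq (hG.trans hH.symm)⟩
  push Not at h8
  have h8' (h : H) : orderOf h ≠ 8 := by
    obtain ⟨g, hg⟩ := hconf.exists_orderOf_eq h
    exact hg ▸ h8 g
  by_cases h4 : ∃ g : G, orderOf g = 4
  · obtain ⟨g, hg⟩ := h4
    obtain ⟨h, hh⟩ := hconf'.exists_orderOf_eq g
    have h2 := hconf 2
    rcases nonempty_mulEquiv_of_orderOf_eq_four hG h8 hg with ⟨⟨e⟩⟩ | ⟨⟨e⟩⟩ | ⟨⟨e⟩⟩ <;>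
    rcases nonempty_mulEquiv_of_orderOf_eq_four hH h8' (hh.trans hg) with
      ⟨⟨e'⟩⟩ | ⟨⟨e'⟩⟩ | ⟨⟨e'⟩⟩ <;>
    first
    | exact ⟨e.trans e'.symm⟩
    | rw [natCard_orderOf_eq_two_congr e, natCard_orderOf_eq_two_congr e'] at h2
      exact absurd h2 (by decide)
  · push Not at h4
    have h4' (h : H) : orderOf h ≠ 4 := by
      obtain ⟨g, hg⟩ := hconf.exists_orderOf_eq h
      exact hg ▸ h4 g
    refine nonempty_mulEquiv_of_forall_sq_eq_one (hG.trans hH.symm) (fun g => ?_) fun h => ?_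
    · rcases orderOf_mem_of_card_eq_eight hG g with hg | hg | hg | hg
      · simp [orderOf_eq_one_iff.1 hg]
      · exact hg ▸ pow_orderOf_eq_one g
      · exact absurd hg (h4 g)
      · exact absurd hg (h8 g)
    · rcases orderOf_mem_of_card_eq_eight hH h with hh | hh | hh | hh
      · simp [orderOf_eq_one_iff.1 hh]
      · exact hh ▸ pow_orderOf_eq_one h
      · exact absurd hh (h4' h)
      · exact absurd hh (h8' h)
end

section
/- There exist two non-isomorphic finite groups of order 72 that are conformal (i.e., 72 ∉ S). -/
/-- The action of the dihedral group of order 8 on `𝔽₃²` by signed permutation matrices: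
`r i` acts as the `i`-th power of the quarter turn, and `sr i` as that followed by the
reflection in the first axis. -/
def faithfulAct : DihedralGroup 4 → ZMod 3 × ZMod 3 → ZMod 3 × ZMod 3
  | .r i, v => (fun w => (-w.2, w.1))^[i.val] v
  | .sr i, v => (fun w => (w.1, -w.2)) ((fun w => (-w.2, w.1))^[i.val] v)

/-- The action of the dihedral group of order 8 on `𝔽₃²` by `±1`, whose kernel is the Klein
four-group generated by `r 2` and `sr 0`. -/
def signAct : DihedralGroup 4 → ZMod 3 × ZMod 3 → ZMod 3 × ZMod 3
  | .r i, v => if i.val % 2 = 0 then v else -v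
  | .sr i, v => if i.val % 2 = 0 then v else -v

/-- An additive action of a group, given as a function, as a homomorphism to the automorphism
group of the multiplicative version of the module. -/
def actionHom {P A : Type*} [Group P] [AddGroup A] (f : P → A → A)
    (h_one : ∀ a, f 1 a = a) (h_mul : ∀ p q a, f (p * q) a = f p (f q a))
    (h_add : ∀ p a b, f p (a + b) = f p a + f p b) : P →* MulAut (Multiplicative A) where
  toFun p :=
    { toFun := fun a => .ofAdd (f p a.toAdd)
      invFun := fun a => .ofAdd (f p⁻¹ a.toAdd)
      left_inv := fun a => by simp [← h_mul, h_one]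
      right_inv := fun a => by simp [← h_mul, h_one]
      map_mul' := fun a b => by simp [h_add] }
  map_one' := by ext a; simp [h_one]
  map_mul' p q := by ext a; simp [h_mul]

/-- The homomorphism given by `faithfulAct`. -/
def faithfulHom : DihedralGroup 4 →* MulAut (Multiplicative (ZMod 3 × ZMod 3)) :=
  actionHom faithfulAct (by decide +kernel) (by decide +kernel) (by decide +kernel)

/-- The homomorphism given by `signAct`. -/
def plusMinusHom : DihedralGroup 4 →* MulAut (Multiplicative (ZMod 3 × ZMod 3)) :=
  actionHom signAct (by decide +kernel) (by decide +kernel) (by decide +kernel)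

instance SemidirectProduct.instFintypeOfProd {N P : Type*} [Group N] [Group P] [Fintype N]
    [Fintype P] (φ : P →* MulAut N) : Fintype (N ⋊[φ] P) :=
  Fintype.ofEquiv (N × P) SemidirectProduct.equivProd.symm

theorem natCard_orderOf_eq {G : Type*} [Group G] [Fintype G] [DecidableEq G] {d : ℕ}
    (hd : 0 < d) :
    Nat.card {g : G // orderOf g = d} =
      (Finset.univ.filter fun g : G => g ^ d = 1 ∧ ∀ m < d, 0 < m → g ^ m ≠ 1).card := by
  simp_rw [orderOf_eq_iff hd]
  rw [Nat.card_eq_fintype_card, Fintype.card_subtype]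

/-- In a group of exponent dividing `n > 0`, no element has order `0` or order exceeding `n`. -/
theorem natCard_orderOf_eq_zero {G : Type*} [Group G] {n d : ℕ} (hn : 0 < n)
    (hG : ∀ g : G, g ^ n = 1) (hd : d ∉ Finset.Icc 1 n) :
    Nat.card {g : G // orderOf g = d} = 0 := by
  have : IsEmpty {g : G // orderOf g = d} := by
    refine ⟨fun ⟨g, hg⟩ => hd ?_⟩
    have hdvd := orderOf_dvd_of_pow_eq_one (hG g)
    rw [hg] at hdvd
    exact Finset.mem_Icc.2 ⟨Nat.pos_of_dvd_of_pos hdvd hn, Nat.le_of_dvd hn hdvd⟩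
  exact Nat.card_of_isEmpty

theorem conformalGroups_of_pow_eq_one {G H : Type*} [Group G] [Group H] [Fintype G] [Fintype H]
    [DecidableEq G] [DecidableEq H] {n : ℕ} (hn : 0 < n)
    (hG : ∀ g : G, g ^ n = 1) (hH : ∀ h : H, h ^ n = 1)
    (h_count : ∀ d ∈ Finset.Icc 1 n,
      (Finset.univ.filter fun g : G => g ^ d = 1 ∧ ∀ m < d, 0 < m → g ^ m ≠ 1).card =
      (Finset.univ.filter fun h : H => h ^ d = 1 ∧ ∀ m < d, 0 < m → h ^ m ≠ 1).card) :
    ConformalGroups G H := by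
  intro d
  by_cases hd : d ∈ Finset.Icc 1 n
  · have hpos : 0 < d := (Finset.mem_Icc.1 hd).1
    rw [natCard_orderOf_eq hpos, natCard_orderOf_eq hpos, h_count d hd]
  · rw [natCard_orderOf_eq_zero hn hG hd, natCard_orderOf_eq_zero hn hH hd]

theorem isEmpty_mulEquiv_of_central {G H : Type*} [Group G] [Group H]
    (hG : ∀ z : G, (∀ g, z * g = g * z) → z = 1) (hH : ∃ z : H, z ≠ 1 ∧ ∀ h, z * h = h * z) :
    IsEmpty (G ≃* H) := by
  refine ⟨fun e => ?_⟩
  obtain ⟨z, hz, hcomm⟩ := hH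
  refine hz (e.symm.map_eq_one_iff.1 (hG _ fun g => e.injective ?_))
  simp [hcomm]

/-- There exist two non-isomorphic finite conformal groups of order 72. -/
theorem stmt_12 :
    ∃ (G H : Type) (_ : Group G) (_ : Group H) (_ : Fintype G) (_ : Fintype H),
      Fintype.card G = 72 ∧ Fintype.card H = 72 ∧
      ConformalGroups G H ∧ IsEmpty (G ≃* H) := by
  refine ⟨Multiplicative (ZMod 3 × ZMod 3) ⋊[faithfulHom] DihedralGroup 4,
    Multiplicative (ZMod 3 × ZMod 3) ⋊[plusMinusHom] DihedralGroup 4,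
    inferInstance, inferInstance, inferInstance, inferInstance,
    by decide +kernel, by decide +kernel,
    conformalGroups_of_pow_eq_one (n := 12) (by norm_num)
      (by decide +kernel) (by decide +kernel) (by decide +kernel),
    isEmpty_mulEquiv_of_central (by decide +kernel) (by decide +kernel)⟩
end

section
/- Let G and H be conformal finite groups. If H is nilpotent, then G is nilpotent. -/
/-- Conformal finite groups admit an order-preserving bijection. -/
theorem ConformalGroups.exists_equiv {G H : Type*} [Group G] [Finite G] [Group H] [Finite H]
    (h : ConformalGroups G H) : ∃ e : G ≃ H, ∀ g, orderOf (e g) = orderOf g :=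
  ⟨Equiv.ofFiberEquiv fun d => (Finite.card_eq.mp (h d)).some,
    fun g => Equiv.ofFiberEquiv_map _ g⟩

/-- A normal Sylow `p`-subgroup of a finite group contains every element of `p`-power order. -/
theorem Sylow.mem_of_normal_of_orderOf_eq_pow {G : Type*} [Group G] [Finite G] {p k : ℕ}
    [Fact p.Prime] (P : Sylow p G) (hP : (P : Subgroup G).Normal) {g : G}
    (hg : orderOf g = p ^ k) : g ∈ P := by
  have hz : IsPGroup p (Subgroup.zpowers g) :=
    IsPGroup.of_card (by rw [Nat.card_zpowers, hg])
  obtain ⟨R, hR⟩ := hz.exists_le_sylow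
  have := Sylow.unique_of_normal P hP
  rw [Subsingleton.elim P R]
  exact hR (Subgroup.mem_zpowers g)

/-- If two finite groups are conformal and one is nilpotent, so is the other. -/
theorem stmt_14 (G H : Type*) [Group G] [Finite G] [Group H] [Finite H]
    (hconf : ConformalGroups G H) (hH : Group.IsNilpotent H) :
    Group.IsNilpotent G := by
  obtain ⟨e, he⟩ := hconf.exists_equiv
  replace hH := ((Group.isNilpotent_of_finite_tfae (G := H)).out 0 3).mp hH
  refine ((Group.isNilpotent_of_finite_tfae (G := G)).out 0 3).mpr ?_
  intro p hp P
  obtain ⟨Q⟩ : Nonempty (Sylow p H) := inferInstance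
  have orderOf_pow : ∀ g ∈ P, ∃ k, orderOf g = p ^ k := by
    intro g hg
    obtain ⟨k, hk⟩ := IsPGroup.iff_orderOf.mp P.isPGroup' ⟨g, hg⟩
    exact ⟨k, by rw [← hk, Subgroup.orderOf_mk]⟩
  have mem_Q : ∀ {g : G} {k : ℕ}, orderOf g = p ^ k → e g ∈ Q := fun {g k} hg =>
    Q.mem_of_normal_of_orderOf_eq_pow (hH p hp Q) ((he g).trans hg)
  have image_eq : e '' (P : Set G) = (Q : Set H) := by
    refine Set.eq_of_subset_of_ncard_le ?_ (le_of_eq ?_) (Set.toFinite _)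
    · rintro _ ⟨g, hg, rfl⟩
      obtain ⟨k, hk⟩ := orderOf_pow g hg
      exact mem_Q hk
    · rw [Set.ncard_image_of_injective _ e.injective]
      change Nat.card Q = Nat.card P
      rw [Q.card_eq_multiplicity, P.card_eq_multiplicity, Nat.card_congr e]
  refine ⟨fun g hg x => ?_⟩
  obtain ⟨k, hk⟩ := orderOf_pow g hg
  have hx : orderOf (x * g * x⁻¹) = p ^ k := by
    rw [← hk, ← MulAut.conj_apply, MulEquiv.orderOf_eq]
  have hmem : e (x * g * x⁻¹) ∈ e '' (P : Set G) := image_eq ▸ mem_Q hx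
  exact (e.injective.mem_set_image).mp hmem
end

section
/- Let G be a finite group and p a prime dividing |G|. If the number of elements of G of p-power order equals the order of a Sylow p-subgroup of G (i.e., equals the largest power of p dividing |G|), then G has a unique Sylow p-subgroup, and this Sylow p-subgroup is normal. -/
/-- If the elements of `p`-power order are as many as the elements of a Sylow `p`-subgroup, then
every Sylow `p`-subgroup consists exactly of these elements. -/
theorem Sylow.coe_eq_setOf_orderOf_eq_pow {G : Type*} [Group G] [Finite G] {p : ℕ}
    [Fact p.Prime]
    (h : Nat.card {g : G // ∃ k : ℕ, orderOf g = p ^ k} = p ^ (Nat.card G).factorization p)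
    (P : Sylow p G) : (P : Set G) = {g : G | ∃ k : ℕ, orderOf g = p ^ k} := by
  refine Set.eq_of_subset_of_ncard_le (fun g hg => ?_) ?_ (Set.toFinite _)
  · obtain ⟨k, hk⟩ := IsPGroup.iff_orderOf.mp P.isPGroup' ⟨g, hg⟩
    exact ⟨k, by rwa [Subgroup.orderOf_mk] at hk⟩
  · exact (h.trans P.card_eq_multiplicity.symm).le

/-- If `p` is a prime dividing the order of a finite group `G` and the number of elements of
`G` of `p`-power order equals the largest power of `p` dividing `|G|` (the order of a Sylow
`p`-subgroup), then `G` has a unique Sylow `p`-subgroup, which is normal. -/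
theorem stmt_17 (G : Type*) [Group G] [Fintype G] (p : ℕ) (hp : p.Prime)
    (hdvd : p ∣ Fintype.card G)
    (h : Nat.card {g : G // ∃ k : ℕ, orderOf g = p ^ k} =
      p ^ (Fintype.card G).factorization p) :
    (∀ P Q : Sylow p G, P = Q) ∧ ∀ P : Sylow p G, (P : Subgroup G).Normal := by
  have : Fact p.Prime := ⟨hp⟩
  rw [← Nat.card_eq_fintype_card] at h
  have unique (P Q : Sylow p G) : P = Q := Sylow.ext <| SetLike.coe_injective <|
    (P.coe_eq_setOf_orderOf_eq_pow h).trans (Q.coe_eq_setOf_orderOf_eq_pow h).symm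
  have : Subsingleton (Sylow p G) := ⟨unique⟩
  exact ⟨unique, fun P => P.normal_of_subsingleton⟩
end

section
/- Let G and H be conformal finite groups and let m be a natural number with gcd(m, |G|/m) = 1. If H has a normal Hall subgroup of order m (a normal subgroup of order m whose order is coprime to its index) and G is solvable, then G has a normal Hall subgroup of order m. -/
/-- A nontrivial solvable group has a nontrivial abelian normal subgroup. -/
theorem exists_normal_isMulCommutative_ne_bot (G : Type*) [Group G] [Nontrivial G]
    [hG : Group.IsSolvable G] :
    ∃ A : Subgroup G, A.Normal ∧ IsMulCommutative A ∧ A ≠ ⊥ := by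
  classical
  have hex : ∃ n, derivedSeries G n = ⊥ := hG.solvable
  obtain ⟨n, hn⟩ : ∃ n, Nat.find hex = n + 1 := by
    refine Nat.exists_eq_succ_of_ne_zero fun h => ?_
    have h0 := Nat.find_spec hex
    rw [h, derivedSeries_zero] at h0
    exact top_ne_bot h0
  refine ⟨derivedSeries G n, derivedSeries_normal G n, ?_, Nat.find_min hex (by lia)⟩
  have hbot := Nat.find_spec hex
  rw [hn, derivedSeries_succ, Subgroup.commutator_eq_bot_iff_le_centralizer] at hbot
  exact ⟨⟨fun a b => Subtype.ext (Subgroup.mem_centralizer_iff.mp (hbot b.2) a a.2)⟩⟩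

/-- A nontrivial finite solvable group has a nontrivial normal subgroup of prime power order. -/
theorem exists_normal_card_eq_prime_pow (G : Type*) [Group G] [Finite G] [Nontrivial G]
    [Group.IsSolvable G] :
    ∃ N : Subgroup G, N.Normal ∧ N ≠ ⊥ ∧ ∃ p j : ℕ, p.Prime ∧ Nat.card N = p ^ j := by
  obtain ⟨A, hA, hcomm, hne⟩ := exists_normal_isMulCommutative_ne_bot G
  have hcard : Nat.card A ≠ 1 := fun h => hne (Subgroup.card_eq_one.mp h)
  have hp : (Nat.card A).minFac.Prime := Nat.minFac_prime hcard
  have : Fact (Nat.card A).minFac.Prime := ⟨hp⟩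
  let P : Sylow (Nat.card A).minFac A := default
  have hPn : (P : Subgroup A).Normal := ⟨fun x hx g => by
    rwa [hcomm.is_comm.comm g x, mul_inv_cancel_right]⟩
  have := P.characteristic_of_normal hPn
  have hmap : Nat.card ((P : Subgroup A).map A.subtype) = Nat.card P :=
    Subgroup.card_map_of_injective A.subtype_injective
  refine ⟨(P : Subgroup A).map A.subtype, inferInstance, fun h => ?_, _, _, hp,
    hmap.trans P.card_eq_multiplicity⟩
  have hdvd : (Nat.card A).minFac ∣ Nat.card P :=
    P.dvd_card_of_dvd_card (Nat.minFac_dvd _)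
  rw [← hmap, h, Subgroup.card_bot] at hdvd
  exact hp.one_lt.ne' (Nat.dvd_one.mp hdvd)

/-- The preimage of a subgroup under the quotient map has order `|K| * |N|`. -/
theorem card_comap_mk' {G : Type*} [Group G] [Finite G] (N : Subgroup G) [N.Normal]
    (K : Subgroup (G ⧸ N)) :
    Nat.card (K.comap (QuotientGroup.mk' N)) = Nat.card K * Nat.card N := by
  have h1 := (K.comap (QuotientGroup.mk' N)).card_mul_index
  rw [Subgroup.index_comap_of_surjective K (QuotientGroup.mk'_surjective N)] at h1
  have h2 := K.card_mul_index
  have h3 := N.card_mul_index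
  rw [Subgroup.index_eq_card, ← h2] at h3
  have h4 : 0 < K.index := Nat.pos_of_ne_zero K.index_ne_zero_of_finite
  exact Nat.eq_of_mul_eq_mul_right h4 (by rw [h1, ← h3]; ring)

/-- **Hall's existence theorem**: a finite solvable group of order `m * k` with `m` and `k`
coprime has a subgroup of order `m`. -/
theorem exists_subgroup_card_eq_of_coprime (G : Type*) [Group G] [Finite G]
    [Group.IsSolvable G] {m k : ℕ} (hcard : Nat.card G = m * k) (hmk : m.Coprime k) :
    ∃ K : Subgroup G, Nat.card K = m := by
  induction hn : Nat.card G using Nat.strong_induction_on generalizing G m k with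
  | _ n ih =>
  rcases subsingleton_or_nontrivial G with _ | _
  · refine ⟨⊥, ?_⟩
    rw [Nat.card_unique] at hcard
    rw [Subgroup.card_bot, Nat.eq_one_of_mul_eq_one_right hcard.symm]
  obtain ⟨N, hN, hne, p, j, hp, hNp⟩ := exists_normal_card_eq_prime_pow G
  have hNpos : 0 < Nat.card N := Nat.card_pos
  have hquot : Nat.card N * Nat.card (G ⧸ N) = m * k := by
    rw [← hcard, ← Subgroup.index_eq_card, N.card_mul_index]
  have hlt : Nat.card (G ⧸ N) < n := by
    have h1 : 1 < Nat.card N := Subgroup.one_lt_card_iff_ne_bot N |>.mpr hne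
    have h2 : 0 < Nat.card (G ⧸ N) := Nat.card_pos
    rw [← hn, hcard, ← hquot]
    exact lt_mul_left h2 h1
  by_cases hpm : p ∣ m
  · have hcop : (Nat.card N).Coprime k := by
      rw [hNp]
      exact Nat.Coprime.pow_left j (hmk.coprime_dvd_left hpm)
    obtain ⟨a, rfl⟩ : Nat.card N ∣ m := hcop.dvd_of_dvd_mul_right ⟨_, hquot.symm⟩
    rw [mul_assoc] at hquot
    obtain ⟨K, hK⟩ := ih _ hlt (G ⧸ N) (Nat.eq_of_mul_eq_mul_left hNpos hquot)
      hmk.coprime_mul_left rfl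
    exact ⟨K.comap (QuotientGroup.mk' N), by rw [card_comap_mk', hK, mul_comm]⟩
  · have hcop : (Nat.card N).Coprime m := by
      rw [hNp]
      exact Nat.Coprime.pow_left j ((Nat.Prime.coprime_iff_not_dvd hp).mpr hpm)
    obtain ⟨b, rfl⟩ : Nat.card N ∣ k := hcop.dvd_of_dvd_mul_left ⟨_, hquot.symm⟩
    rw [mul_left_comm] at hquot
    obtain ⟨K, hK⟩ := ih _ hlt (G ⧸ N) (Nat.eq_of_mul_eq_mul_left hNpos hquot)
      hmk.coprime_mul_left_right rfl
    set L := K.comap (QuotientGroup.mk' N) with hL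
    have hNL : N ≤ L := QuotientGroup.le_comap_mk' N K
    have hLcard : Nat.card L = m * Nat.card N := by rw [hL, card_comap_mk', hK]
    have hN' : Nat.card (N.subgroupOf L) = Nat.card N :=
      Nat.card_congr (Subgroup.subgroupOfEquivOfLe hNL).toEquiv
    have hidx : (N.subgroupOf L).index = m := by
      have h := (N.subgroupOf L).card_mul_index
      rw [hN', hLcard, mul_comm] at h
      exact Nat.eq_of_mul_eq_mul_right hNpos h
    obtain ⟨C, hC⟩ := Subgroup.exists_right_complement'_of_coprime (N := N.subgroupOf L)
      (by rwa [hN', hidx])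
    refine ⟨C.map L.subtype, ?_⟩
    rw [Subgroup.card_map_of_injective L.subtype_injective, ← hidx]
    exact hC.symm.index_eq_card.symm

/-- A normal Hall subgroup contains every element whose order divides its order. -/
theorem mem_of_orderOf_dvd_card {H : Type*} [Group H] {N : Subgroup H} [N.Normal]
    (hN : (Nat.card N).Coprime N.index) {x : H} (hx : orderOf x ∣ Nat.card N) : x ∈ N := by
  rw [← QuotientGroup.eq_one_iff, ← orderOf_eq_one_iff]
  refine Nat.eq_one_of_dvd_coprimes hN
    ((orderOf_map_dvd (QuotientGroup.mk' N) x).trans hx) ?_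
  rw [Subgroup.index_eq_card]
  exact orderOf_dvd_natCard _

/-- If `G` and `H` are conformal finite groups, `m` is coprime to `|G| / m`, `H` has a
normal Hall subgroup of order `m`, and `G` is solvable, then `G` has a normal Hall subgroup
of order `m`. -/
theorem stmt_18 (G H : Type*) [Group G] [Fintype G] [Group H] [Fintype H]
    (hconf : ConformalGroups G H) (m : ℕ)
    (hm : Nat.Coprime m (Fintype.card G / m))
    (hH : ∃ N : Subgroup H, N.Normal ∧ Nat.card N = m ∧ Nat.Coprime (Nat.card N) N.index)
    (hsolv : IsSolvable G) :
    ∃ N : Subgroup G, N.Normal ∧ Nat.card N = m ∧ Nat.Coprime (Nat.card N) N.index := by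
  have : Group.IsSolvable G := hsolv
  obtain ⟨N, hN, rfl, hcop⟩ := hH
  obtain ⟨e, he⟩ := hconf.exists_equiv
  have hcard : Nat.card G = Nat.card N * N.index := by
    rw [N.card_mul_index, Nat.card_congr e]
  obtain ⟨K, hK⟩ := exists_subgroup_card_eq_of_coprime G hcard hcop
  have hKS : (K : Set G) = {g | orderOf g ∣ Nat.card N} := by
    refine Set.eq_of_subset_of_ncard_le (fun g hg => ?_) ?_ (Set.toFinite _)
    · exact hK ▸ K.orderOf_dvd_natCard hg
    · calc Set.ncard {g : G | orderOf g ∣ Nat.card N} ≤ Set.ncard (N : Set H) :=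
            Set.ncard_le_ncard_of_injOn e
              (fun g hg => mem_of_orderOf_dvd_card hcop (by rw [he]; exact hg))
              e.injective.injOn (Set.toFinite _)
        _ = Nat.card N := Nat.card_coe_set_eq _ |>.symm
        _ = Nat.card K := hK.symm
        _ = Set.ncard (K : Set G) := Nat.card_coe_set_eq _
  have hmem (g : G) : g ∈ K ↔ orderOf g ∣ Nat.card N := Set.ext_iff.mp hKS g
  refine ⟨K, ⟨fun x hx g => ?_⟩, hK, ?_⟩
  · rw [hmem] at hx ⊢
    rwa [← MulAut.conj_apply, MulEquiv.orderOf_eq]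
  · have hidx := K.card_mul_index
    rw [hcard, hK] at hidx
    rwa [hK, Nat.eq_of_mul_eq_mul_left Nat.card_pos hidx]
end
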